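/- arXiv:2502.11060 — 7 statements merged into one kernel-verified Lean document; each statement's English description precedes it below -/
import Mathlib

section
/- Let (b_n)_{n≥0} be the sequence of polynomials with natural-number coefficients defined by b_0 = 1, b_1 = x, and for n ≥ 2, b_n(x) = Σ_{0≤i≤n-1, i≢n (mod 2)} (x+2)·b_i(x+3) + Σ_{0≤i≤n-1, i≡n (mod 2)} (x+3)·b_i(x) + Σ_{0≤i≤n-1, i≢n (mod 2)} b_i(x). Then for every n ≥ 0, the polynomial b_n has nonnegative integer coefficients and degree exactly n. -/
open Polynomial Finset

/-- With `b` the sequence of polynomials in `ℕ[X]` (hence with nonnegative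
integer coefficients) defined by `b 0 = 1`, `b 1 = X` and the recursion of Definition
`defin_bi`, the polynomial `b n` has degree exactly `n` for every `n`. -/
theorem stmt_1 (b : ℕ → Polynomial ℕ)
    (hb0 : b 0 = 1) (hb1 : b 1 = Polynomial.X)
    (hbn : ∀ n, 2 ≤ n → b n =
      (∑ i ∈ (Finset.range n).filter (fun i => ¬ i % 2 = n % 2),
        (Polynomial.X + 2) * ((b i).comp (Polynomial.X + 3)))
      + (∑ i ∈ (Finset.range n).filter (fun i => i % 2 = n % 2),
        (Polynomial.X + 3) * b i)
      + (∑ i ∈ (Finset.range n).filter (fun i => ¬ i % 2 = n % 2), b i)) :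
    ∀ n : ℕ, (b n).degree = n := by
  have h2 : (X + 2 : ℕ[X]).natDegree = 1 := natDegree_X_add_C 2
  have h3 : (X + 3 : ℕ[X]).natDegree = 1 := natDegree_X_add_C 3
  have hterm : ∀ i, (b i).degree = (i : ℕ) →
      ((X + 2) * ((b i).comp (X + 3))).degree = ((i + 1 : ℕ) : WithBot ℕ) := by
    intro i hi
    have hnd : ((b i).comp (X + 3)).natDegree = i := by
      rw [natDegree_comp, h3, mul_one]
      exact natDegree_eq_of_degree_eq_some hi
    have hm : ((X + 2 : ℕ[X])).Monic := monic_X_add_C 2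
    have hm3 : ((X + 3 : ℕ[X])).Monic := monic_X_add_C 3
    have hb : b i ≠ 0 := by
      intro h
      rw [h, degree_zero] at hi
      exact absurd hi (by simp)
    have hc : (b i).comp (X + 3) ≠ 0 := by
      rw [← leadingCoeff_ne_zero, leadingCoeff_comp (by rw [h3]; norm_num), hm3.leadingCoeff]
      simpa using hb
    rw [degree_mul, degree_eq_natDegree hc, hnd, degree_eq_natDegree hm.ne_zero, h2]
    push_cast
    rw [add_comm]
  intro n
  induction n using Nat.strong_induction_on with
  | _ n ih =>
    rcases Nat.lt_or_ge n 2 with hn | hn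
    · interval_cases n
      · simp [hb0]
      · simp [hb1]
    · have hr := hbn n hn
      apply le_antisymm
      · rw [hr]
        refine (degree_add_le _ _).trans (max_le ((degree_add_le _ _).trans (max_le ?_ ?_)) ?_)
        · refine (degree_sum_le _ _).trans (Finset.sup_le fun i hi => ?_)
          have hi' : i < n := by simp at hi; omega
          rw [hterm i (ih i hi')]
          exact_mod_cast hi'
        · refine (degree_sum_le _ _).trans (Finset.sup_le fun i hi => ?_)
          have hi' : i < n := by simp at hi; omega
          rw [degree_mul, ih i hi']
          refine (add_le_add_left (degree_le_natDegree) _).trans ?_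
          rw [h3]
          exact_mod_cast (by omega : 1 + i ≤ n)
        · refine (degree_sum_le _ _).trans (Finset.sup_le fun i hi => ?_)
          have hi' : i < n := by simp at hi; omega
          rw [ih i hi']
          exact_mod_cast hi'.le
      · apply le_degree_of_ne_zero
        rw [hr, coeff_add, coeff_add, finsetSum_coeff]
        have hmem : n - 1 ∈ (Finset.range n).filter (fun i => ¬ i % 2 = n % 2) := by
          simp; omega
        have hs := Finset.single_le_sum
          (f := fun i => ((X + 2) * ((b i).comp (X + 3))).coeff n)
          (fun i _ => Nat.zero_le _) hmem
        have hd := hterm (n - 1) (ih (n - 1) (by omega))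
        rw [Nat.sub_add_cancel (by omega)] at hd
        have hne := coeff_ne_zero_of_eq_degree hd
        omega
end

section
/- Let (b_n)_{n≥0} be the sequence of polynomials with natural-number coefficients defined by b_0 = 1, b_1 = x, and for n ≥ 2, b_n(x) = Σ_{0≤i≤n-1, i≢n (mod 2)} (x+2)·b_i(x+3) + Σ_{0≤i≤n-1, i≡n (mod 2)} (x+3)·b_i(x) + Σ_{0≤i≤n-1, i≢n (mod 2)} b_i(x). Then for every n ≥ 3 and every real number x ≥ 0, one has b_n(x) ≤ (Σ_{i=0}^{n-1} b_i(x+3))·(x+3). -/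
open Polynomial Finset

/-- With `b` the sequence of polynomials in `ℕ[X]` defined by `b 0 = 1`,
`b 1 = X` and the recursion of Definition `defin_bi`, for every `n ≥ 3` and every real
`x ≥ 0` we have `b n (x) ≤ (∑_{i < n} b i (x + 3)) * (x + 3)`. -/
theorem stmt_2 (b : ℕ → Polynomial ℕ)
    (hb0 : b 0 = 1) (hb1 : b 1 = Polynomial.X)
    (hbn : ∀ n, 2 ≤ n → b n =
      (∑ i ∈ (Finset.range n).filter (fun i => ¬ i % 2 = n % 2),
        (Polynomial.X + 2) * ((b i).comp (Polynomial.X + 3)))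
      + (∑ i ∈ (Finset.range n).filter (fun i => i % 2 = n % 2),
        (Polynomial.X + 3) * b i)
      + (∑ i ∈ (Finset.range n).filter (fun i => ¬ i % 2 = n % 2), b i)) :
    ∀ n : ℕ, 3 ≤ n → ∀ x : ℝ, 0 ≤ x →
      Polynomial.aeval x (b n) ≤ (∑ i ∈ Finset.range n, Polynomial.aeval (x + 3) (b i)) * (x + 3) := by
  intro n hn x hx
  have mono : ∀ p : Polynomial ℕ, Polynomial.aeval x p ≤ Polynomial.aeval (x + 3) p := by
    intro p
    rw [Polynomial.aeval_eq_sum_range, Polynomial.aeval_eq_sum_range]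
    refine Finset.sum_le_sum fun i _ => ?_
    rw [nsmul_eq_mul, nsmul_eq_mul]
    gcongr
    linarith
  rw [hbn n (by omega)]
  simp only [map_add, map_sum, map_mul, Polynomial.aeval_X, Polynomial.aeval_comp, map_ofNat]
  rw [← Finset.sum_filter_add_sum_filter_not (Finset.range n) (fun i => i % 2 = n % 2)
    (fun i => Polynomial.aeval (x + 3) (b i)), add_mul]
  have h1 := Finset.sum_le_sum (s := (Finset.range n).filter (fun i => i % 2 = n % 2))
    (fun i _ => mono (b i))
  have h2 := Finset.sum_le_sum (s := (Finset.range n).filter (fun i => ¬ i % 2 = n % 2))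
    (fun i _ => mono (b i))
  rw [← Finset.mul_sum, ← Finset.mul_sum]
  have h3 := mul_le_mul_of_nonneg_left h1 (by linarith : 0 ≤ x + 3)
  linarith
end

section
/- Let (c_n)_{n≥0} be the sequence of polynomials defined by c_0 = 1, c_1 = x, and for n ≥ 2, c_n(x) = (Σ_{i=0}^{n-1} c_i(x+3))·(x+3). Then for every n ≥ 3 and every real number x ≥ 0, one has c_n(x) ≤ c_{n-1}(x+3)·(x+4). -/
open Polynomial Finset

/-- With `c` the sequence of polynomials over `ℤ` defined by `c 0 = 1`,
`c 1 = X` and, for `n ≥ 2`, `c n = (∑_{i < n} (c i)(X + 3)) * (X + 3)`, for every `n ≥ 3`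
and every real `x ≥ 0` we have `c n (x) ≤ c (n-1) (x + 3) * (x + 4)`. -/
theorem stmt_4 (c : ℕ → Polynomial ℤ)
    (hc0 : c 0 = 1) (hc1 : c 1 = Polynomial.X)
    (hcn : ∀ n, 2 ≤ n → c n =
      (∑ i ∈ Finset.range n, (c i).comp (Polynomial.X + 3)) * (Polynomial.X + 3)) :
    ∀ n : ℕ, 3 ≤ n → ∀ x : ℝ, 0 ≤ x →
      Polynomial.aeval x (c n) ≤ Polynomial.aeval (x + 3) (c (n - 1)) * (x + 4) := by
  have hf : ∀ n, 2 ≤ n → ∀ x : ℝ, Polynomial.aeval x (c n) =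
      (∑ i ∈ Finset.range n, Polynomial.aeval (x + 3) (c i)) * (x + 3) := by
    intro n hn x
    rw [hcn n hn]
    have h3 : Polynomial.aeval x (3 : Polynomial ℤ) = 3 := map_ofNat (Polynomial.aeval x) 3
    simp [Polynomial.aeval_comp, h3]
  have hm : ∀ n, ∀ x y : ℝ, 0 ≤ x → x ≤ y →
      0 ≤ Polynomial.aeval x (c n) ∧ Polynomial.aeval x (c n) ≤ Polynomial.aeval y (c n) := by
    intro n
    induction n using Nat.strong_induction_on with
    | _ n ih =>
      intro x y hx hxy
      rcases Nat.lt_or_ge n 2 with h | h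
      · interval_cases n
        · simp [hc0]
        · simp [hc1, hx, hxy]
      · have h0 : ∀ i ∈ Finset.range n, 0 ≤ Polynomial.aeval (x + 3) (c i) := fun i hi =>
          (ih i (Finset.mem_range.1 hi) (x + 3) (y + 3) (by linarith) (by linarith)).1
        have h1 : ∀ i ∈ Finset.range n,
            Polynomial.aeval (x + 3) (c i) ≤ Polynomial.aeval (y + 3) (c i) := fun i hi =>
          (ih i (Finset.mem_range.1 hi) (x + 3) (y + 3) (by linarith) (by linarith)).2
        have h2 := Finset.sum_nonneg h0
        have h3 := Finset.sum_le_sum h1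
        rw [hf n h x, hf n h y]
        exact ⟨mul_nonneg h2 (by linarith),
          mul_le_mul h3 (by linarith) (by linarith) (h2.trans h3)⟩
  intro n hn x hx
  obtain ⟨m, rfl⟩ : ∃ m, n = m + 1 := ⟨n - 1, by omega⟩
  have h := (hm m x (x + 3) hx (by linarith)).2
  rw [hf m (by omega) x] at h
  rw [hf (m + 1) (by omega) x, Finset.sum_range_succ, Nat.add_sub_cancel]
  linarith
end

section
/- Let (c_n)_{n≥0} be the sequence of polynomials defined by c_0 = 1, c_1 = x, and for n ≥ 2, c_n(x) = (Σ_{i=0}^{n-1} c_i(x+3))·(x+3). Then for every n ≥ 3 and every real number x ≥ 0, one has c_n(x) ≤ (x + 3n − 3)·∏_{i=1}^{n-1}(x + 3i + 1). -/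
open Polynomial Finset

/-- With `c` the sequence of polynomials over `ℤ` defined by `c 0 = 1`,
`c 1 = X` and, for `n ≥ 2`, `c n = (∑_{i < n} (c i)(X + 3)) * (X + 3)`, for every `n ≥ 3`
and every real `x ≥ 0` we have `c n (x) ≤ (x + 3n - 3) * ∏_{i=1}^{n-1} (x + 3i + 1)`. -/
theorem stmt_5 (c : ℕ → Polynomial ℤ)
    (hc0 : c 0 = 1) (hc1 : c 1 = Polynomial.X)
    (hcn : ∀ n, 2 ≤ n → c n =
      (∑ i ∈ Finset.range n, (c i).comp (Polynomial.X + 3)) * (Polynomial.X + 3)) :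
    ∀ n : ℕ, 3 ≤ n → ∀ x : ℝ, 0 ≤ x →
      Polynomial.aeval x (c n) ≤
        (x + 3 * (n : ℝ) - 3) * ∏ i ∈ Finset.Icc 1 (n - 1), (x + 3 * (i : ℝ) + 1) := by
  have hrec : ∀ m : ℕ, ∀ x : ℝ, aeval x (c (m + 3)) =
      aeval x (c (m + 2)) + (x + 3) * aeval (x + 3) (c (m + 2)) := by
    intro m x
    have h : c (m + 3) = c (m + 2) + (c (m + 2)).comp (X + 3) * (X + 3) := by
      rw [hcn (m + 3) (by omega), Finset.sum_range_succ, add_mul, ← hcn (m + 2) (by omega)]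
    rw [h]
    simp only [map_add, map_mul, aeval_comp, aeval_X, map_ofNat]
    ring
  have key : ∀ m : ℕ, ∀ x : ℝ, 0 ≤ x → aeval x (c (m + 2)) ≤
      (x + 3 * (m : ℝ) + 3) * ∏ i ∈ Finset.range (m + 1), (x + 3 * (i : ℝ) + 4) := by
    intro m
    induction m with
    | zero =>
      intro x hx
      rw [hcn 2 le_rfl]
      simp [Finset.sum_range_succ, hc0, hc1]
      have h3 : aeval x (3 : ℤ[X]) = 3 := map_ofNat _ 3
      rw [h3]
      apply le_of_eq
      ring
    | succ m ih =>
      intro x hx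
      have h1 := ih x hx
      have h2 := ih (x + 3) (by linarith)
      rw [show m + 1 + 2 = m + 3 from rfl, hrec]
      set R : ℝ := ∏ i ∈ Finset.range m, (x + 3 * (i : ℝ) + 7) with hR
      have hR0 : 0 ≤ R := Finset.prod_nonneg fun i _ => by positivity
      have e1 : ∏ i ∈ Finset.range (m + 1), (x + 3 * (i : ℝ) + 4) = R * (x + 4) := by
        rw [Finset.prod_range_succ', hR]
        congr 1
        · refine Finset.prod_congr rfl fun i _ => ?_
          push_cast; ring
        · simp
      have e2 : ∏ i ∈ Finset.range (m + 1), (x + 3 + 3 * (i : ℝ) + 4)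
          = R * (x + 3 * m + 7) := by
        rw [Finset.prod_range_succ, hR]
        congr 1
        · refine Finset.prod_congr rfl fun i _ => ?_
          ring
        · ring
      rw [Finset.prod_range_succ, e1]
      rw [e1] at h1
      rw [e2] at h2
      have h3 := mul_le_mul_of_nonneg_left h2 (show 0 ≤ x + 3 by linarith)
      have hm : (0 : ℝ) ≤ m := Nat.cast_nonneg m
      have h4 : 0 ≤ R * ((x + 3 * m + 6) * (x + 3 * m + 7) - (x + 3 * m + 3) * (x + 4)) := by
        apply mul_nonneg hR0
        nlinarith [mul_nonneg hx hm, mul_nonneg hm hm]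
      push_cast
      nlinarith [h1, h3, h4]
  intro n hn x hx
  obtain ⟨m, rfl⟩ : ∃ m, n = m + 2 := ⟨n - 2, by omega⟩
  have h := key m x hx
  have e : ∏ i ∈ Finset.Icc 1 (m + 2 - 1), (x + 3 * (i : ℝ) + 1)
      = ∏ i ∈ Finset.range (m + 1), (x + 3 * (i : ℝ) + 4) := by
    rw [show m + 2 - 1 = m + 1 from rfl, ← Finset.Ico_add_one_right_eq_Icc,
      Finset.prod_Ico_eq_prod_range]
    refine Finset.prod_congr rfl fun i _ => ?_
    push_cast; ring
  rw [e]
  convert h using 2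
  push_cast; ring
end

section
/- Let (b_n)_{n≥0} be the sequence of polynomials with natural-number coefficients defined by b_0 = 1, b_1 = x, and for n ≥ 2, b_n(x) = Σ_{0≤i≤n-1, i≢n (mod 2)} (x+2)·b_i(x+3) + Σ_{0≤i≤n-1, i≡n (mod 2)} (x+3)·b_i(x) + Σ_{0≤i≤n-1, i≢n (mod 2)} b_i(x). Let (c_n)_{n≥0} be defined by c_0 = 1, c_1 = x, and for n ≥ 2, c_n(x) = (Σ_{i=0}^{n-1} c_i(x+3))·(x+3). Then for every n ≥ 0 and every real number x ≥ 0, one has b_n(x) ≤ c_n(x). -/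
open Polynomial Finset

theorem aeval_nat_mono (p : Polynomial ℕ) {x y : ℝ} (hx : 0 ≤ x) (hxy : x ≤ y) :
    Polynomial.aeval x p ≤ Polynomial.aeval y p := by
  rw [Polynomial.aeval_eq_sum_range, Polynomial.aeval_eq_sum_range]
  refine Finset.sum_le_sum fun i _ => ?_
  simp only [nsmul_eq_mul]
  gcongr

/-- With `b` the sequence of polynomials in `ℕ[X]` of Definition `defin_bi`
and `c` the sequence of polynomials in `ℕ[X]` defined by `c 0 = 1`, `c 1 = X` and, for
`n ≥ 2`, `c n = (∑_{i < n} (c i)(X + 3)) * (X + 3)`, for every `n` and every real `x ≥ 0`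
we have `b n (x) ≤ c n (x)`. -/
theorem stmt_6 (b c : ℕ → Polynomial ℕ)
    (hb0 : b 0 = 1) (hb1 : b 1 = Polynomial.X)
    (hbn : ∀ n, 2 ≤ n → b n =
      (∑ i ∈ (Finset.range n).filter (fun i => ¬ i % 2 = n % 2),
        (Polynomial.X + 2) * ((b i).comp (Polynomial.X + 3)))
      + (∑ i ∈ (Finset.range n).filter (fun i => i % 2 = n % 2),
        (Polynomial.X + 3) * b i)
      + (∑ i ∈ (Finset.range n).filter (fun i => ¬ i % 2 = n % 2), b i))
    (hc0 : c 0 = 1) (hc1 : c 1 = Polynomial.X)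
    (hcn : ∀ n, 2 ≤ n → c n =
      (∑ i ∈ Finset.range n, (c i).comp (Polynomial.X + 3)) * (Polynomial.X + 3)) :
    ∀ n : ℕ, ∀ x : ℝ, 0 ≤ x →
      Polynomial.aeval x (b n) ≤ Polynomial.aeval x (c n) := by
  intro n
  induction n using Nat.strong_induction_on with
  | _ n ih =>
    intro x hx
    rcases Nat.lt_or_ge n 2 with h | h
    · interval_cases n
      · rw [hb0, hc0]
      · rw [hb1, hc1]
    · rw [hbn n h, hcn n h, add_right_comm, ← Finset.sum_add_distrib, add_comm]
      have hX2 : Polynomial.aeval x (Polynomial.X + 2 : Polynomial ℕ) = x + 2 := by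
        rw [map_add, Polynomial.aeval_X, map_ofNat]
      have hX3 : Polynomial.aeval x (Polynomial.X + 3 : Polynomial ℕ) = x + 3 := by
        rw [map_add, Polynomial.aeval_X, map_ofNat]
      rw [Finset.sum_mul, ← Finset.sum_filter_add_sum_filter_not (Finset.range n)
        (fun i => i % 2 = n % 2)]
      simp only [map_add (Polynomial.aeval x) (Finset.sum _ _), map_sum]
      refine add_le_add (Finset.sum_le_sum fun i hi => ?_) (Finset.sum_le_sum fun i hi => ?_)
      all_goals
        have hin : i < n := Finset.mem_range.1 (Finset.mem_filter.1 hi).1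
        have h1 := ih i hin x hx
        have h2 := ih i hin (x + 3) (by linarith)
        have h3 := aeval_nat_mono (c i) hx (show x ≤ x + 3 by linarith)
      · rw [map_mul, map_mul, Polynomial.aeval_comp, hX3]
        nlinarith
      · rw [map_add, map_mul, map_mul, Polynomial.aeval_comp, Polynomial.aeval_comp, hX3, hX2]
        nlinarith
end

section
/- Let (b_n)_{n≥0} be the sequence of polynomials with natural-number coefficients defined by b_0 = 1, b_1 = x, and for n ≥ 2, b_n(x) = Σ_{0≤i≤n-1, i≢n (mod 2)} (x+2)·b_i(x+3) + Σ_{0≤i≤n-1, i≡n (mod 2)} (x+3)·b_i(x) + Σ_{0≤i≤n-1, i≢n (mod 2)} b_i(x). Then for every n ≥ 3 and every real number x ≥ 0, one has b_n(x) ≤ (x + 3n − 3)·∏_{j=1}^{n-1}(x + 3j + 1). -/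
open Polynomial Finset

/-- The shifted product used in the bound. -/
noncomputable def auxP (m : ℕ) (x : ℝ) : ℝ := ∏ j ∈ Finset.range m, (x + 3 * ((j : ℝ) + 1) + 1)

theorem auxP_succ (m : ℕ) (x : ℝ) : auxP (m + 1) x = auxP m x * (x + 3 * m + 4) := by
  unfold auxP
  rw [Finset.prod_range_succ]
  ring

theorem auxP_succ' (m : ℕ) (x : ℝ) : auxP (m + 1) x = (x + 4) * auxP m (x + 3) := by
  unfold auxP
  rw [Finset.prod_range_succ', mul_comm]
  congr 1
  · push_cast; ring
  · refine Finset.prod_congr rfl fun j _ => ?_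
    push_cast; ring

theorem auxP_nonneg (m : ℕ) (x : ℝ) (hx : 0 ≤ x) : 0 ≤ auxP m x :=
  Finset.prod_nonneg fun j _ => by positivity

theorem aux_bound (f : ℕ → ℝ → ℝ)
    (h2 : ∀ x, 0 ≤ x → f 2 x ≤ (x + 3) * (x + 4))
    (h3 : ∀ x, 0 ≤ x → f 3 x ≤ (x + 6) * ((x + 4) * (x + 7)))
    (hr : ∀ m x, f (m + 4) x = (x + 2) * f (m + 3) (x + 3) + f (m + 3) x + (x + 4) * f (m + 2) x)
    (m : ℕ) : (∀ x, 0 ≤ x → f (m + 2) x ≤ (x + 3 * m + 3) * auxP (m + 1) x) ∧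
      (∀ x, 0 ≤ x → f (m + 3) x ≤ (x + 3 * m + 6) * auxP (m + 2) x) := by
  induction m with
  | zero =>
    constructor
    · intro x hx
      have := h2 x hx
      simp [auxP]
      linarith
    · intro x hx
      have := h3 x hx
      simp [auxP, Finset.prod_range_succ]
      linarith
  | succ m ih =>
    obtain ⟨ih1, ih2⟩ := ih
    constructor
    · intro x hx
      have := ih2 x hx
      push_cast
      rw [show m + 1 + 2 = m + 3 by ring, show m + 1 + 1 = m + 2 by ring]
      linarith
    · intro x hx
      rw [show m + 1 + 3 = m + 4 by ring, show m + 1 + 2 = m + 3 by ring, hr]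
      have a1 := ih2 (x + 3) (by linarith)
      have a2 := ih2 x hx
      have a3 := ih1 x hx
      have hR := auxP_nonneg m (x + 3) (by linarith)
      rw [auxP_succ, auxP_succ] at a1
      rw [auxP_succ', auxP_succ] at a2
      rw [auxP_succ'] at a3
      rw [auxP_succ', auxP_succ, auxP_succ]
      push_cast at *
      generalize auxP m (x + 3) = R at *
      generalize f (m + 3) (x + 3) = u at *
      generalize f (m + 3) x = v at *
      generalize f (m + 2) x = w at *
      have hm : (0 : ℝ) ≤ m := Nat.cast_nonneg m
      generalize (m : ℝ) = t at *
      have b1 := mul_le_mul_of_nonneg_left a1 (by linarith : 0 ≤ x + 2)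
      have b3 := mul_le_mul_of_nonneg_left a3 (by linarith : 0 ≤ x + 4)
      have key : 0 ≤ R * (2 * (x + 3 * t + 9) * (x + 3 * t + 7) * (x + 3 * t + 10)
          - (x + 3 * t + 6) * (x + 4) * (x + 3 * t + 7) - (x + 4) ^ 2 * (x + 3 * t + 3)) := by
        apply mul_nonneg hR
        ring_nf
        positivity
      nlinarith [b1, b3, a2, key]

theorem stmt_7 (b : ℕ → Polynomial ℕ)
    (hb0 : b 0 = 1) (hb1 : b 1 = Polynomial.X)
    (hbn : ∀ n, 2 ≤ n → b n =
      (∑ i ∈ (Finset.range n).filter (fun i => ¬ i % 2 = n % 2),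
        (Polynomial.X + 2) * ((b i).comp (Polynomial.X + 3)))
      + (∑ i ∈ (Finset.range n).filter (fun i => i % 2 = n % 2),
        (Polynomial.X + 3) * b i)
      + (∑ i ∈ (Finset.range n).filter (fun i => ¬ i % 2 = n % 2), b i)) :
    ∀ n : ℕ, 3 ≤ n → ∀ x : ℝ, 0 ≤ x →
      Polynomial.aeval x (b n) ≤
        (x + 3 * (n : ℝ) - 3) * ∏ j ∈ Finset.Icc 1 (n - 1), (x + 3 * (j : ℝ) + 1) := by
  have e2 : b 2 = (X + 2) * (X + 3) + (X + 3) + X := by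
    rw [hbn 2 le_rfl]
    simp [Finset.sum_filter, Finset.sum_range_succ, hb0, hb1]
  have e3 : b 3 = (X + 2) * (1 + (b 2).comp (X + 3)) + (X + 3) * X + (1 + b 2) := by
    rw [hbn 3 (by norm_num)]
    simp [Finset.sum_filter, Finset.sum_range_succ, hb0, hb1]
    ring
  have er : ∀ m, b (m + 4) = (X + 2) * (b (m + 3)).comp (X + 3) + b (m + 3)
      + (X + 4) * b (m + 2) := by
    intro m
    have h4 := hbn (m + 4) (by omega)
    have h2 := hbn (m + 2) (by omega)
    have p1 : (m + 4) % 2 = (m + 2) % 2 := by omega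
    have p2 : ¬ (m + 3) % 2 = (m + 2) % 2 := by omega
    rw [p1] at h4
    simp only [Finset.sum_filter] at h4 h2
    have hs : ∀ g : ℕ → Polynomial ℕ, ∑ i ∈ Finset.range (m + 4), g i
        = ∑ i ∈ Finset.range (m + 2), g i + g (m + 2) + g (m + 3) := by
      intro g
      rw [Finset.sum_range_succ, Finset.sum_range_succ]
    rw [hs, hs, hs] at h4
    simp only [p2, not_true_eq_false, not_false_eq_true, if_true, if_false, add_zero] at h4
    rw [h4]
    have h5 : (X + 4) * b (m + 2) = (X + 3) * b (m + 2) + b (m + 2) := by ring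
    rw [h5]
    generalize b (m + 2) = c at h2 ⊢
    nth_rewrite 3 [h2]
    ring
  have c2 : ∀ x : ℝ, aeval x (2 : Polynomial ℕ) = 2 := fun x => map_ofNat _ 2
  have c3 : ∀ x : ℝ, aeval x (3 : Polynomial ℕ) = 3 := fun x => map_ofNat _ 3
  have c4 : ∀ x : ℝ, aeval x (4 : Polynomial ℕ) = 4 := fun x => map_ofNat _ 4
  have key := aux_bound (fun n x => Polynomial.aeval x (b n))
    (by intro x hx
        simp [e2, c2, c3]
        nlinarith)
    (by intro x hx
        simp [e3, e2, c2, c3, Polynomial.aeval_comp]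
        ring_nf
        nlinarith)
    (by intro m x
        simp [er, c2, c3, c4, Polynomial.aeval_comp])
  intro n hn x hx
  obtain ⟨m, rfl⟩ : ∃ m, n = m + 3 := ⟨n - 3, by omega⟩
  have h := (key m).2 x hx
  refine h.trans (le_of_eq ?_)
  have hp : ∏ j ∈ Finset.Icc 1 (m + 3 - 1), (x + 3 * (j : ℝ) + 1) = auxP (m + 2) x := by
    unfold auxP
    rw [show m + 3 - 1 = m + 2 by omega, Finset.range_eq_Ico,
      ← Finset.Ico_add_one_right_eq_Icc, Finset.prod_Ico_eq_prod_range,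
      Finset.prod_Ico_eq_prod_range]
    refine Finset.prod_congr (by simp) fun j _ => ?_
    push_cast; ring
  rw [hp]
  push_cast; ring
end

section
/- Let 𝔽 be a finite field and let f : X → S be a proper morphism of schemes of finite type over 𝔽 such that for every point s of S the fiber X_s = X ×_S Spec κ(s) has Krull dimension at most d. Then there exists a natural number C such that for every closed point s ∈ S, every integer n ≥ 1, and every finite field extension K of the residue field κ(s) with [K : κ(s)] = n, the set of κ(s)-scheme morphisms Spec K → X_s is finite of cardinality at most C · (card κ(s))^{n·d}. -/
open AlgebraicGeometry CategoryTheory Limits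
set_option linter.style.haveILetI false

open scoped nonZeroDivisors in
lemma LW_dim_le (F L : Type*) [Field F] [CommRing L] [Algebra F L] (e d : ℕ)
    (g : MvPolynomial (Fin e) F →ₐ[F] L) (hg : Function.Injective g) (hi : g.IsIntegral)
    (hd : ringKrullDim L ≤ d) : e ≤ d := by
  letI : Algebra (MvPolynomial (Fin e) F) L := g.toRingHom.toAlgebra
  haveI : Algebra.IsIntegral (MvPolynomial (Fin e) F) L := ⟨hi⟩
  have h1 : (e : WithBot ℕ∞) ≤ ringKrullDim (MvPolynomial (Fin e) F) := by
    rw [MvPolynomial.ringKrullDim_of_isNoetherianRing]; simp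
  have h2 : ringKrullDim (MvPolynomial (Fin e) F) ≤ ringKrullDim L := by
    refine iSup_le fun l => ?_
    obtain ⟨Q, -, hQ, hQ2⟩ := Ideal.exists_ideal_over_prime_of_isIntegral (S := L) l.head.asIdeal ⊥
      (by
        intro x hx
        have : g x = 0 := hx
        rw [(map_eq_zero_iff g hg).mp this]; exact zero_mem _)
    haveI : Q.LiesOver (RelSeries.head l).asIdeal := ⟨hQ2.symm⟩
    obtain ⟨L', hL, -⟩ := Ideal.exists_ltSeries_of_hasGoingUp l Q
    rw [← hL]
    exact Order.LTSeries.length_le_krullDim L'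
  exact_mod_cast h1.trans (h2.trans hd)

open scoped nonZeroDivisors in
lemma LW_spread (A B : Type) [CommRing A] [IsDomain A] [CommRing B] [Algebra A B]
    [Algebra.FiniteType A B] (d : ℕ)
    (hd : ringKrullDim (Localization (Algebra.algebraMapSubmonoid B A⁰)) ≤ d) :
    ∃ e ≤ d, ∃ b : Fin e → B, ∀ z : B, ∃ m : A, m ≠ 0 ∧ ∃ n : A, n ≠ 0 ∧
      ∃ q : Polynomial (MvPolynomial (Fin e) A), q.Monic ∧
        algebraMap A B n * q.eval₂ (MvPolynomial.aeval b).toRingHom (algebraMap A B m * z) = 0 := by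
  set L := Localization (Algebra.algebraMapSubmonoid B A⁰)
  let F := FractionRing A
  haveI : IsScalarTower A F L := isScalarTower_localizationAlgebra A⁰ B
  rcases subsingleton_or_nontrivial L with hL | hL
  · refine ⟨0, Nat.zero_le _, Fin.elim0, fun z => ⟨1, one_ne_zero, ?_⟩⟩
    have h1 : algebraMap B L 1 = 0 := Subsingleton.elim _ _
    rw [IsLocalization.map_eq_zero_iff (Algebra.algebraMapSubmonoid B A⁰)] at h1
    obtain ⟨⟨_, n, hn, rfl⟩, h⟩ := h1
    refine ⟨n, nonZeroDivisors.ne_zero hn, 1, Polynomial.monic_one, ?_⟩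
    simpa using h
  · haveI : Algebra.FiniteType F L := by
      haveI : IsLocalization (Submonoid.map (algebraMap A B) A⁰) L :=
        inferInstanceAs (IsLocalization (Algebra.algebraMapSubmonoid B A⁰) L)
      have := RingHom.finiteType_localizationPreserves (algebraMap A B) A⁰ F L
        (RingHom.finiteType_algebraMap.mpr inferInstance)
      exact this
    obtain ⟨e, g, hg, hi⟩ := exists_integral_inj_algHom_of_fg F L
    refine ⟨e, LW_dim_le F L e d g hg hi hd, ?_⟩
    have hx : ∀ i, ∃ b : B, ∃ m : A, m ≠ 0 ∧
        algebraMap B L b = algebraMap F L (algebraMap A F m) * g (.X i) := by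
      intro i
      obtain ⟨⟨b, ⟨_, m, hm, rfl⟩⟩, h⟩ := IsLocalization.surj (Algebra.algebraMapSubmonoid B A⁰) (g (.X i))
      refine ⟨b, m, nonZeroDivisors.ne_zero hm, ?_⟩
      rw [← h, mul_comm, ← IsScalarTower.algebraMap_apply, ← IsScalarTower.algebraMap_apply]
    choose b m hm hb using hx
    refine ⟨b, fun z => ?_⟩
    let h : MvPolynomial (Fin e) F →ₐ[F] L := MvPolynomial.aeval (fun i => algebraMap B L (b i))
    have hgh : g = h.comp (MvPolynomial.aeval
        (fun i => MvPolynomial.C (algebraMap A F (m i))⁻¹ * MvPolynomial.X i)) := by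
      apply MvPolynomial.algHom_ext
      intro i
      have hmi : algebraMap A F (m i) ≠ 0 := by simpa using hm i
      simp only [AlgHom.comp_apply, MvPolynomial.aeval_X, map_mul, h, hb, MvPolynomial.aeval_C]
      rw [← mul_assoc, ← map_mul, inv_mul_cancel₀ hmi, map_one, one_mul]
    have hint : h.toRingHom.IsIntegral := by
      rw [hgh] at hi
      exact RingHom.IsIntegral.tower_top _ _ hi
    let R := MvPolynomial (Fin e) A
    letI : Algebra R (MvPolynomial (Fin e) F) := MvPolynomial.algebraMvPolynomial
    letI : Algebra (MvPolynomial (Fin e) F) L := h.toRingHom.toAlgebra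
    letI : Algebra R L := ((algebraMap B L).comp (MvPolynomial.aeval b).toRingHom).toAlgebra
    have hmap : algebraMap R (MvPolynomial (Fin e) F) = MvPolynomial.map (algebraMap A F) := rfl
    haveI : IsScalarTower R (MvPolynomial (Fin e) F) L := by
      refine IsScalarTower.of_algebraMap_eq' ?_
      apply MvPolynomial.ringHom_ext
      · intro a
        rw [RingHom.comp_apply, hmap]
        simp [RingHom.algebraMap_toAlgebra, h, ← IsScalarTower.algebraMap_apply]
        rfl
      · intro i
        rw [RingHom.comp_apply, hmap]
        simp [RingHom.algebraMap_toAlgebra, h]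
    have hloc : IsLocalization (A⁰.map (MvPolynomial.C (σ := Fin e))) (MvPolynomial (Fin e) F) :=
      MvPolynomial.isLocalization A⁰ F
    obtain ⟨⟨_, k, hk, rfl⟩, q, hq, hq'⟩ := IsIntegral.exists_multiple_integral_of_isLocalization
      (A⁰.map (MvPolynomial.C (σ := Fin e))) (Rₘ := MvPolynomial (Fin e) F)
      (algebraMap B L z) (hint _)
    refine ⟨k, nonZeroDivisors.ne_zero hk, ?_⟩
    have h3 : algebraMap B L
      (q.eval₂ (MvPolynomial.aeval b).toRingHom (algebraMap A B k * z)) = 0 := by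
      rw [Polynomial.hom_eval₂, ← hq']
      congr 1
      rw [Submonoid.smul_def, Algebra.smul_def]
      simp [RingHom.algebraMap_toAlgebra]
    rw [IsLocalization.map_eq_zero_iff (Algebra.algebraMapSubmonoid B A⁰)] at h3
    obtain ⟨⟨_, n, hn, rfl⟩, h⟩ := h3
    exact ⟨n, nonZeroDivisors.ne_zero hn, q, hq, h⟩

open scoped nonZeroDivisors in
lemma LW_count_dom (A B : Type) [CommRing A] [IsDomain A] [CommRing B] [Algebra A B]
    [Algebra.FiniteType A B] (d : ℕ)
    (hd : ringKrullDim (Localization (Algebra.algebraMapSubmonoid B A⁰)) ≤ d) :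
    ∃ a : A, a ≠ 0 ∧ ∃ C : ℕ, ∀ (K : Type) [Field K] [Finite K] (φ : A →+* K), φ a ≠ 0 →
      {ψ : B →+* K | ψ.comp (algebraMap A B) = φ}.Finite ∧
      {ψ : B →+* K | ψ.comp (algebraMap A B) = φ}.ncard ≤ C * Nat.card K ^ d := by
  classical
  obtain ⟨e, hed, b, hb⟩ := LW_spread A B d hd
  choose m hm n hn q hq hqe using hb
  obtain ⟨s, hs⟩ := (Algebra.FiniteType.out : (⊤ : Subalgebra A B).FG)
  refine ⟨∏ z ∈ s, m z * n z, Finset.prod_ne_zero_iff.mpr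
    fun z _ => mul_ne_zero (hm z) (hn z), ∏ z : s, (q z).natDegree, ?_⟩
  intro K _ _ φ hφ
  letI := Fintype.ofFinite K
  rw [map_prod, Finset.prod_ne_zero_iff] at hφ
  have hφm : ∀ z ∈ s, φ (m z) ≠ 0 := fun z hz h => hφ z hz (by rw [map_mul, h, zero_mul])
  have hφn : ∀ z ∈ s, φ (n z) ≠ 0 := fun z hz h => hφ z hz (by rw [map_mul, h, mul_zero])
  let T : Finset (Σ _ : Fin e → K, (s → K)) := (Finset.univ).sigma (fun v =>
    Fintype.piFinset fun z : s => ((q z).map (MvPolynomial.eval₂Hom φ v)).roots.toFinset)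
  let G : (B →+* K) → (Σ _ : Fin e → K, (s → K)) :=
    fun ψ => ⟨fun i => ψ (b i), fun z => φ (m z) * ψ z⟩
  have hmaps : ∀ ψ ∈ {ψ : B →+* K | ψ.comp (algebraMap A B) = φ}, G ψ ∈ (T : Set _) := by
    intro ψ hψ
    have hψ' : ∀ a, ψ (algebraMap A B a) = φ a := fun a => by rw [← (show _ = φ from hψ)]; rfl
    simp only [T, G, Finset.mem_coe, Finset.mem_sigma, Finset.mem_univ, true_and,
      Fintype.mem_piFinset, Multiset.mem_toFinset]
    intro z
    rw [Polynomial.mem_roots (((hq z).map _).ne_zero), Polynomial.IsRoot, Polynomial.eval_map]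
    have h1 := congrArg ψ (hqe z)
    rw [map_mul, map_zero, hψ', mul_eq_zero, or_iff_right (hφn z z.2), Polynomial.hom_eval₂,
      map_mul, hψ'] at h1
    rw [← h1]
    congr 1
    apply MvPolynomial.ringHom_ext
    · intro a; simp [hψ']
    · intro i; simp
  have hinj : Set.InjOn G {ψ : B →+* K | ψ.comp (algebraMap A B) = φ} := by
    intro ψ hψ ψ' hψ' h
    simp only [G, Sigma.mk.injEq, heq_eq_eq] at h
    letI : Algebra A K := φ.toAlgebra
    let f1 : B →ₐ[A] K := { ψ with commutes' := fun a => RingHom.congr_fun hψ a }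
    let f2 : B →ₐ[A] K := { ψ' with commutes' := fun a => RingHom.congr_fun hψ' a }
    have : f1 = f2 := by
      apply AlgHom.ext_of_adjoin_eq_top hs
      intro z hz
      exact mul_left_cancel₀ (hφm z hz) (congrFun h.2 ⟨z, hz⟩)
    ext x
    exact AlgHom.congr_fun this x
  refine ⟨Set.Finite.of_injOn hmaps hinj T.finite_toSet, ?_⟩
  refine (Set.ncard_le_ncard_of_injOn G hmaps hinj T.finite_toSet).trans ?_
  rw [Set.ncard_coe_finset, Finset.card_sigma]
  calc _ ≤ ∑ v : Fin e → K, ∏ z : s, (q z).natDegree := by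
        refine Finset.sum_le_sum fun v _ => ?_
        rw [Fintype.card_piFinset]
        refine Finset.prod_le_prod' fun z _ => ?_
        refine (Multiset.toFinset_card_le _).trans ((Polynomial.card_roots' _).trans ?_)
        exact Polynomial.natDegree_map_le
    _ = (∏ z : s, (q z).natDegree) * Nat.card K ^ e := by
        rw [Finset.sum_const, Finset.card_univ, Fintype.card_fun, Fintype.card_fin,
          Nat.card_eq_fintype_card, smul_eq_mul, mul_comm]
    _ ≤ _ := by
        gcongr
        exact Nat.card_pos

open scoped nonZeroDivisors in
lemma LW_count_ideal (A B : Type) [CommRing A] [IsNoetherianRing A] [CommRing B] [Algebra A B]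
    [Algebra.FiniteType A B] (d : ℕ)
    (hd : ∀ p : PrimeSpectrum A,
      topologicalKrullDim (PrimeSpectrum.comap (algebraMap A B) ⁻¹' {p}) ≤ (d : WithBot ℕ∞))
    (I : Ideal A) :
    ∃ C : ℕ, ∀ (K : Type) [Field K] [Finite K] (φ : A →+* K), I ≤ RingHom.ker φ →
      {ψ : B →+* K | ψ.comp (algebraMap A B) = φ}.Finite ∧
      {ψ : B →+* K | ψ.comp (algebraMap A B) = φ}.ncard ≤ C * Nat.card K ^ d := by
  induction I using WellFoundedGT.induction with
  | ind I ih =>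
  have hlt : ∀ a, a ∉ I → I < I ⊔ Ideal.span {a} := fun a ha => by
    refine lt_of_le_of_ne le_sup_left fun h => ha ?_
    rw [h]
    exact Ideal.mem_sup_right (Ideal.mem_span_singleton_self a)
  have hle : ∀ (a : A) (K : Type) [Field K] (φ : A →+* K), I ≤ RingHom.ker φ → φ a = 0 →
      I ⊔ Ideal.span {a} ≤ RingHom.ker φ := fun a K _ φ h h' => by
    refine sup_le h ?_
    rw [Ideal.span_singleton_le_iff_mem]
    exact h'
  by_cases htop : I = ⊤
  · refine ⟨0, fun K _ _ φ h => ?_⟩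
    exact absurd (top_le_iff.mp (htop ▸ h)) (RingHom.ker_ne_top φ)
  by_cases hp : I.IsPrime
  · let A' := A ⧸ I
    let B' := B ⧸ I.map (algebraMap A B)
    haveI : Algebra.FiniteType A B' := inferInstance
    haveI : Algebra.FiniteType A' B' := Algebra.FiniteType.of_restrictScalars_finiteType A A' B'
    have hdim : ringKrullDim (Localization (Algebra.algebraMapSubmonoid B' A'⁰)) ≤ d := by
      set L := Localization (Algebra.algebraMapSubmonoid B' A'⁰)
      rw [← PrimeSpectrum.topologicalKrullDim_eq_ringKrullDim]
      refine le_trans ?_ (hd ⟨I, hp⟩)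
      let g : PrimeSpectrum L → PrimeSpectrum B := fun x =>
        PrimeSpectrum.comap (Ideal.Quotient.mk (I.map (algebraMap A B)))
          (PrimeSpectrum.comap (algebraMap B' L) x)
      have hg : Topology.IsInducing g :=
        (PrimeSpectrum.isClosedEmbedding_comap_of_surjective _ _
          Ideal.Quotient.mk_surjective).isInducing.comp
          (PrimeSpectrum.localization_comap_isInducing L (Algebra.algebraMapSubmonoid B' A'⁰))
      have hgm : ∀ x, g x ∈ PrimeSpectrum.comap (algebraMap A B) ⁻¹' {(⟨I, hp⟩ : PrimeSpectrum A)} := by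
        intro x
        rw [Set.mem_preimage, Set.mem_singleton_iff]
        ext a
        have h0 : a ∈ (PrimeSpectrum.comap (algebraMap A B) (g x)).asIdeal ↔
          algebraMap B' L (algebraMap A' B' (Ideal.Quotient.mk I a)) ∈ x.asIdeal := Iff.rfl
        rw [h0]
        constructor
        · intro h
          by_contra hc
          have hc' : Ideal.Quotient.mk I a ≠ 0 := fun h => hc (Ideal.Quotient.eq_zero_iff_mem.mp h)
          have hu : IsUnit (algebraMap B' L (algebraMap A' B' (Ideal.Quotient.mk I a))) :=
            IsLocalization.map_units L (⟨_, _, mem_nonZeroDivisors_of_ne_zero hc', rfl⟩ :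
              Algebra.algebraMapSubmonoid B' A'⁰)
          exact x.2.ne_top (Ideal.eq_top_of_isUnit_mem _ h hu)
        · intro h
          rw [Ideal.Quotient.eq_zero_iff_mem.mpr h]
          simp
      exact (hg.codRestrict hgm).topologicalKrullDim_le
    obtain ⟨a', ha', C, hC⟩ := LW_count_dom A' B' d hdim
    obtain ⟨a, rfl⟩ := Ideal.Quotient.mk_surjective a'
    obtain ⟨C2, hC2⟩ := ih _ (hlt a fun h => ha' (Ideal.Quotient.eq_zero_iff_mem.mpr h))
    refine ⟨C + C2, fun K _ _ φ h => ?_⟩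
    by_cases h0 : φ a = 0
    · obtain ⟨h1, h2⟩ := hC2 K φ (hle a K φ h h0)
      refine ⟨h1, h2.trans ?_⟩
      gcongr
      omega
    · obtain ⟨h1, h2⟩ := hC K (Ideal.Quotient.lift I φ h) (show φ a ≠ 0 from h0)
      have hsub : {ψ : B →+* K | ψ.comp (algebraMap A B) = φ} ⊆
          (fun ψ : B' →+* K => ψ.comp (Ideal.Quotient.mk (I.map (algebraMap A B)))) ''
          {ψ : B' →+* K | ψ.comp (algebraMap A' B') = Ideal.Quotient.lift I φ h} := by
        intro ψ hψ
        have hk : ∀ x ∈ I.map (algebraMap A B), ψ x = 0 := by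
          intro x hx
          have : I.map (algebraMap A B) ≤ RingHom.ker ψ := by
            rw [Ideal.map_le_iff_le_comap]
            intro y hy
            have h3 : φ y = 0 := h hy
            rw [← (show _ = φ from hψ)] at h3
            exact h3
          exact this hx
        refine ⟨Ideal.Quotient.lift _ ψ hk, ?_, ?_⟩
        · apply Ideal.Quotient.ringHom_ext
          ext y
          exact RingHom.congr_fun hψ y
        · ext y; rfl
      refine ⟨(h1.image _).subset hsub, ?_⟩
      refine (Set.ncard_le_ncard hsub (h1.image _)).trans ((Set.ncard_image_le h1).trans
        (h2.trans ?_))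
      gcongr
      omega
  · obtain ⟨a, ha, b, hb, hab⟩ : ∃ a, a ∉ I ∧ ∃ b, b ∉ I ∧ a * b ∈ I := by
      by_contra! hc
      exact hp ⟨htop, fun {x y} hxy => by
        by_contra! h
        exact hc x h.1 y h.2 hxy⟩
    obtain ⟨C1, hC1⟩ := ih _ (hlt a ha)
    obtain ⟨C2, hC2⟩ := ih _ (hlt b hb)
    refine ⟨C1 + C2, fun K _ _ φ h => ?_⟩
    have h0 : φ a * φ b = 0 := by rw [← map_mul]; exact h hab
    rcases mul_eq_zero.mp h0 with h0 | h0
    · obtain ⟨h1, h2⟩ := hC1 K φ (hle a K φ h h0)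
      refine ⟨h1, h2.trans ?_⟩
      gcongr
      omega
    · obtain ⟨h1, h2⟩ := hC2 K φ (hle b K φ h h0)
      refine ⟨h1, h2.trans ?_⟩
      gcongr
      omega

lemma LW_pair (X S : Scheme.{0}) [IsLocallyNoetherian S] (f : X ⟶ S) [LocallyOfFiniteType f]
    (d : ℕ) (hdim : ∀ s : S,
      topologicalKrullDim ↥(Limits.pullback f (S.fromSpecResidueField s)) ≤ (d : WithBot ℕ∞))
    (U : S.Opens) (V : X.Opens) (hU : IsAffineOpen U) (hV : IsAffineOpen V) (e : V ≤ f ⁻¹ᵁ U) :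
    ∃ C : ℕ, ∀ (K : Type) [Field K] [Finite K] (t : Spec (CommRingCat.of K) ⟶ S),
      {h : Spec (CommRingCat.of K) ⟶ X | h ≫ f = t ∧ Set.range h ⊆ (V : Set X)}.Finite ∧
      {h : Spec (CommRingCat.of K) ⟶ X | h ≫ f = t ∧ Set.range h ⊆ (V : Set X)}.ncard ≤
        C * Nat.card K ^ d := by
  let A := Γ(S, U)
  let B := Γ(X, V)
  have hcomm := IsAffineOpen.SpecMap_appLE_fromSpec f hU hV e
  letI : Algebra A B := (f.appLE U V e).hom.toAlgebra
  haveI : IsNoetherianRing A := IsLocallyNoetherian.component_noetherian ⟨U, hU⟩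
  haveI : Algebra.FiniteType A B := f.finiteType_appLE hU hV e
  have hd : ∀ p : PrimeSpectrum A,
      topologicalKrullDim (PrimeSpectrum.comap (algebraMap A B) ⁻¹' {p}) ≤ (d : WithBot ℕ∞) := by
    intro p
    refine le_trans ?_ (hdim (hU.fromSpec p))
    have h1 : topologicalKrullDim (f ⁻¹' {hU.fromSpec p}) ≤
      topologicalKrullDim ↥(Limits.pullback f (S.fromSpecResidueField (hU.fromSpec p))) :=
      (f.fiberHomeo (hU.fromSpec p)).symm.isInducing.topologicalKrullDim_le
    refine le_trans ?_ h1
    have hg : Topology.IsInducing (fun x : PrimeSpectrum.comap (algebraMap A B) ⁻¹' {p} =>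
        hV.fromSpec x.1) :=
      hV.fromSpec.isOpenEmbedding.isInducing.comp Topology.IsInducing.subtypeVal
    refine (hg.codRestrict (s := f ⁻¹' {hU.fromSpec p}) ?_).topologicalKrullDim_le
    rintro ⟨x, hx⟩
    have h2 : f (hV.fromSpec x) = hU.fromSpec (Spec.map (f.appLE U V e) x) := by
      exact (congrArg (fun k : Spec Γ(X, V) ⟶ S => k x) hcomm).symm
    rw [Set.mem_preimage, Set.mem_singleton_iff, h2]
    congr 1
  obtain ⟨C, hC⟩ := LW_count_ideal A B d hd ⊥
  refine ⟨C, fun K _ _ t => ?_⟩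
  have hlift : ∀ h : Spec (CommRingCat.of K) ⟶ X, Set.range h ⊆ (V : Set X) →
      ∃ ψ : B →+* K, Spec.map (CommRingCat.ofHom ψ) ≫ hV.fromSpec = h := by
    intro h hh
    have hr : Set.range h ⊆ Set.range hV.fromSpec := by rwa [hV.range_fromSpec]
    refine ⟨(Spec.preimage (IsOpenImmersion.lift hV.fromSpec h hr)).hom, ?_⟩
    rw [CommRingCat.ofHom_hom, Spec.map_preimage, IsOpenImmersion.lift_fac]
  set T := {h : Spec (CommRingCat.of K) ⟶ X | h ≫ f = t ∧ Set.range h ⊆ (V : Set X)} with hT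
  rcases T.eq_empty_or_nonempty with h0 | ⟨h0, h0t, h0V⟩
  · rw [h0]; simp
  obtain ⟨ψ0, hψ0⟩ := hlift h0 h0V
  obtain ⟨h1, h2⟩ := hC K (ψ0.comp (algebraMap A B)) bot_le
  have hsub : T ⊆ (fun ψ : B →+* K => Spec.map (CommRingCat.ofHom ψ) ≫ hV.fromSpec) ''
      {ψ : B →+* K | ψ.comp (algebraMap A B) = ψ0.comp (algebraMap A B)} := by
    rintro h ⟨ht, hhV⟩
    obtain ⟨ψ, hψ⟩ := hlift h hhV
    refine ⟨ψ, ?_, hψ⟩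
    have h3 : Spec.map (f.appLE U V e ≫ CommRingCat.ofHom ψ) =
        Spec.map (f.appLE U V e ≫ CommRingCat.ofHom ψ0) := by
      rw [← cancel_mono hU.fromSpec, Spec.map_comp, Spec.map_comp, Category.assoc, Category.assoc,
        hcomm, ← Category.assoc, hψ, ht, ← Category.assoc, hψ0, h0t]
    have h4 := Spec.map_injective h3
    exact congrArg CommRingCat.Hom.hom h4
  refine ⟨(h1.image _).subset hsub, ?_⟩
  exact (Set.ncard_le_ncard hsub (h1.image _)).trans ((Set.ncard_image_le h1).trans h2)

lemma LW_finite_residue (𝔽 : Type) [Field 𝔽] [Finite 𝔽] (S : Scheme.{0})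
    (fS : S ⟶ Spec (CommRingCat.of 𝔽)) [LocallyOfFiniteType fS] (s : S)
    (hs : IsClosed ({s} : Set S)) : Finite (S.residueField s) := by
  have hfin : IsFinite (S.fromSpecResidueField s ≫ fS) := by
    rw [isClosed_singleton_iff_isClosedImmersion] at hs
    rw [isFinite_iff_locallyOfFiniteType_of_jacobsonSpace]
    infer_instance
  rw [← Spec.map_preimage (S.fromSpecResidueField s ≫ fS), IsFinite.SpecMap_iff] at hfin
  letI : Algebra 𝔽 (S.residueField s) :=
    (Spec.preimage (S.fromSpecResidueField s ≫ fS)).hom.toAlgebra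
  haveI : Module.Finite 𝔽 (S.residueField s) := hfin
  exact Module.finite_of_finite 𝔽

/-- `relative_Lang_Weil`: Let `f : X ⟶ S` be a proper morphism of schemes
of finite type over a finite field `𝔽` whose fibers `X ×_S Spec κ(s)` all have Krull
dimension at most `d`.  Then there is `C : ℕ` such that for every closed point `s ∈ S`,
every `n ≥ 1` and every degree `n` field extension `K` of the residue field `κ(s)`, the
set of `κ(s)`-morphisms `Spec K ⟶ X_s` is finite of cardinality at most
`C * (card κ(s)) ^ (n * d)`. -/
theorem stmt_10 (𝔽 : Type) [Field 𝔽] [Finite 𝔽]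
    (X S : AlgebraicGeometry.Scheme)
    (fX : X ⟶ AlgebraicGeometry.Spec (CommRingCat.of 𝔽))
    (fS : S ⟶ AlgebraicGeometry.Spec (CommRingCat.of 𝔽))
    [AlgebraicGeometry.LocallyOfFiniteType fX] [AlgebraicGeometry.QuasiCompact fX]
    [AlgebraicGeometry.LocallyOfFiniteType fS] [AlgebraicGeometry.QuasiCompact fS]
    (f : X ⟶ S) (hf : f ≫ fS = fX) [AlgebraicGeometry.IsProper f]
    (d : ℕ)
    (hdim : ∀ s : S,
      topologicalKrullDim ↥(Limits.pullback f (S.fromSpecResidueField s)) ≤ (d : WithBot ℕ∞)) :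
    ∃ C : ℕ, ∀ s : S, IsClosed ({s} : Set S) →
      ∀ n : ℕ, 1 ≤ n →
      ∀ (K : Type) (_ : Field K) (_ : Algebra ↥(S.residueField s) K)
        (_ : FiniteDimensional ↥(S.residueField s) K),
        Module.finrank ↥(S.residueField s) K = n →
        (Finite {g : AlgebraicGeometry.Spec (CommRingCat.of K) ⟶
              Limits.pullback f (S.fromSpecResidueField s) //
            g ≫ Limits.pullback.snd f (S.fromSpecResidueField s) =
              AlgebraicGeometry.Spec.map
                (CommRingCat.ofHom (algebraMap ↥(S.residueField s) K))} ∧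
          Nat.card {g : AlgebraicGeometry.Spec (CommRingCat.of K) ⟶
              Limits.pullback f (S.fromSpecResidueField s) //
            g ≫ Limits.pullback.snd f (S.fromSpecResidueField s) =
              AlgebraicGeometry.Spec.map
                (CommRingCat.ofHom (algebraMap ↥(S.residueField s) K))} ≤
            C * Nat.card ↥(S.residueField s) ^ (n * d)) := by
  classical
  haveI : IsLocallyNoetherian S := LocallyOfFiniteType.isLocallyNoetherian fS
  haveI : CompactSpace X := (quasiCompact_iff_compactSpace fX).mp inferInstance
  have hpair : ∀ x : X, ∃ U : S.Opens, ∃ V : X.Opens, IsAffineOpen U ∧ IsAffineOpen V ∧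
      x ∈ V ∧ V ≤ f ⁻¹ᵁ U := by
    intro x
    obtain ⟨U, hU, hxU, -⟩ := exists_isAffineOpen_mem_and_subset (X := S) (x := f x) (U := ⊤) trivial
    obtain ⟨V, hV, hxV, hVU⟩ := exists_isAffineOpen_mem_and_subset (X := X) (x := x) (U := f ⁻¹ᵁ U) hxU
    exact ⟨U, V, hU, hV, hxV, hVU⟩
  choose U V hU hV hxV hVU using hpair
  obtain ⟨I, hI⟩ := CompactSpace.elim_nhds_subcover (fun x => (V x : Set X))
    (fun x => (V x).isOpen.mem_nhds (hxV x))
  have hC := fun x => LW_pair X S f d hdim (U x) (V x) (hU x) (hV x) (hVU x)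
  choose C hC using hC
  refine ⟨∑ x ∈ I, C x, ?_⟩
  intro s hs n hn K _ _ _ hKn
  haveI : Finite (S.residueField s) := LW_finite_residue 𝔽 S fS s hs
  haveI : Finite K := Module.finite_of_finite (S.residueField s)
  have hcard : Nat.card K = Nat.card (S.residueField s) ^ n := by
    rw [Module.natCard_eq_pow_finrank (K := S.residueField s), hKn]
  rw [pow_mul, ← hcard]
  let t : Spec (CommRingCat.of K) ⟶ S := Spec.map
    (CommRingCat.ofHom (algebraMap ↥(S.residueField s) K)) ≫ S.fromSpecResidueField s
  let T := ⋃ x ∈ I, {h : Spec (CommRingCat.of K) ⟶ X | h ≫ f = t ∧ Set.range h ⊆ (V x : Set X)}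
  have hTfin : T.Finite := I.finite_toSet.biUnion fun x _ => (hC x K t).1
  have hTcard : T.ncard ≤ (∑ x ∈ I, C x) * Nat.card K ^ d := by
    rw [Finset.sum_mul]
    refine (Finset.set_ncard_biUnion_le I _).trans (Finset.sum_le_sum fun x _ => (hC x K t).2)
  let G : {g : Spec (CommRingCat.of K) ⟶ Limits.pullback f (S.fromSpecResidueField s) //
            g ≫ Limits.pullback.snd f (S.fromSpecResidueField s) =
              Spec.map (CommRingCat.ofHom (algebraMap ↥(S.residueField s) K))} → T :=
    fun g => ⟨g.1 ≫ pullback.fst _ _, by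
      have h1 : (g.1 ≫ pullback.fst f (S.fromSpecResidueField s)) ≫ f = t := by
        rw [Category.assoc, pullback.condition, ← Category.assoc, g.2]
      let y : Spec (CommRingCat.of K) := IsLocalRing.closedPoint K
      have h2 : (g.1 ≫ pullback.fst f (S.fromSpecResidueField s)) y ∈ (⊤ : Set X) := trivial
      rw [← hI] at h2
      simp only [Set.mem_iUnion] at h2
      obtain ⟨x, hx, hy⟩ := h2
      refine Set.mem_biUnion hx ⟨h1, ?_⟩
      rintro _ ⟨y', rfl⟩
      have : y' = y := Subsingleton.elim (α := PrimeSpectrum K) _ _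
      rw [this]
      exact hy⟩
  have hG : Function.Injective G := by
    intro g g' h
    apply Subtype.ext
    apply pullback.hom_ext
    · exact congrArg Subtype.val h
    · rw [g.2, g'.2]
  haveI : Finite T := hTfin
  exact ⟨Finite.of_injective G hG, (Nat.card_le_card_of_injective G hG).trans hTcard⟩
end
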